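/- Let η₁, η₂ be the basic quasi-periods of the Weierstrass zeta function associated to a lattice basis ω₁, ω₂ of Λ with ω₁/ω₂ in the upper half plane. Then the Legendre relation holds: ω₁η₂ − ω₂η₁ = 2πi. -/

import Mathlib

open Complex

/-- The lattice point `p₁ω₁ + p₂ω₂`. -/
noncomputable def latticePoint (ω₁ ω₂ : ℂ) (p : ℤ × ℤ) : ℂ := p.1 * ω₁ + p.2 * ω₂

/-- The Weierstrass zeta function, the logarithmic derivative of the Weierstrass sigma
function, for the lattice `Λ = ω₁ℤ + ω₂ℤ`. -/
noncomputable def wZeta (ω₁ ω₂ z : ℂ) : ℂ :=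
  1 / z + ∑' p : {p : ℤ × ℤ // p ≠ 0},
    (1 / (z - latticePoint ω₁ ω₂ p.1) + 1 / latticePoint ω₁ ω₂ p.1 +
      z / latticePoint ω₁ ω₂ p.1 ^ 2)

open Filter Topology UpperHalfPlane SummationFilter EisensteinSeries

lemma legendre_tendsto_inv (ω c : ℂ) (hω : ω ≠ 0) (s : ℂ) (hs : s = 1 ∨ s = -1) :
    Tendsto (fun b : ℕ ↦ 1 / (c + s * b * ω)) atTop (𝓝 0) := by
  simp only [one_div]
  apply tendsto_inv₀_cobounded.comp
  rw [← tendsto_norm_atTop_iff_cobounded]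
  have hn : ‖s‖ = 1 := by rcases hs with rfl | rfl <;> simp
  have h1 : Tendsto (fun b : ℕ ↦ (b : ℝ) * ‖ω‖ - ‖c‖) atTop atTop :=
    tendsto_atTop_add_const_right _ _
      (tendsto_natCast_atTop_atTop.atTop_mul_const (norm_pos_iff.mpr hω))
  refine tendsto_atTop_mono (fun b ↦ ?_) h1
  have := norm_sub_norm_le (s * b * ω) (-c)
  simp only [norm_neg, norm_mul, hn, one_mul, Complex.norm_natCast, sub_neg_eq_add] at this
  rwa [add_comm c]

/-- The inner telescoping sum. -/
lemma legendre_telescope (ω c z : ℂ) (hω : ω ≠ 0) :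
    HasSum (fun m : ℤ ↦ 1 / (z + ω - (m * ω + c)) - 1 / (z - (m * ω + c))) 0
      (symmetricIco ℤ) := by
  rw [hasSum_symmetricIco_int_iff]
  have key : ∀ b : ℕ, ∑ n ∈ Finset.Ico (-b : ℤ) b,
      (1 / (z + ω - (n * ω + c)) - 1 / (z - (n * ω + c))) =
      1 / ((z + ω - c) + 1 * b * ω) - 1 / ((z + ω - c) + (-1) * b * ω) := by
    intro b
    have := Finset.sum_Ico_int_sub b (fun n : ℤ ↦ 1 / (z + ω - (n * ω + c)))
    convert! this using 2
    · rename_i n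
      congr 2
      push_cast
      ring
    · congr 1; push_cast; ring
    · congr 1; push_cast; ring
  simp_rw [key]
  simpa using (legendre_tendsto_inv ω (z + ω - c) hω 1 (by simp)).sub
    (legendre_tendsto_inv ω (z + ω - c) hω (-1) (by simp))

lemma legendre_inner (ω c z : ℂ) (hω : ω ≠ 0)
    (hq : Summable (fun m : ℤ ↦ 1 / (m * ω + c) ^ 2))
    (hs : Summable (fun m : ℤ ↦ 1 / (z + ω - (m * ω + c)) - 1 / (z - (m * ω + c))
      + ω * (1 / (m * ω + c) ^ 2))) :
    ∑' m : ℤ, (1 / (z + ω - (m * ω + c)) - 1 / (z - (m * ω + c))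
      + ω * (1 / (m * ω + c) ^ 2)) = ω * ∑' m : ℤ, 1 / (m * ω + c) ^ 2 := by
  rw [← tsum_eq_of_summable_unconditional (L := symmetricIco ℤ) hs]
  apply HasSum.tsum_eq
  have h2 : HasSum (fun m : ℤ ↦ ω * (1 / (m * ω + c) ^ 2)) (ω * ∑' m : ℤ, 1 / (m * ω + c) ^ 2)
      (symmetricIco ℤ) := by
    have h3 := (hq.mul_left ω).hasSum
    rw [tsum_mul_left] at h3
    exact h3.mono_left (SummationFilter.LeAtTop.le_atTop)
  simpa using (legendre_telescope ω c z hω).add h2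

/-- The summand of the zeta function. -/
noncomputable def legF (ω₁ ω₂ z : ℂ) (p : ℤ × ℤ) : ℂ :=
  1 / (z - latticePoint ω₁ ω₂ p) + 1 / latticePoint ω₁ ω₂ p + z / latticePoint ω₁ ω₂ p ^ 2

lemma legendre_point_eq (ω₁ ω₂ : ℂ) (h2 : ω₂ ≠ 0) (p : ℤ × ℤ) :
    latticePoint ω₁ ω₂ p = ω₂ * (p.1 * (ω₁ / ω₂) + p.2) := by
  unfold latticePoint; field_simp

lemma legendre_summable_cube (ω₁ ω₂ : ℂ) (h : 0 < (ω₁ / ω₂).im) :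
    Summable (fun p : ℤ × ℤ ↦ (‖latticePoint ω₁ ω₂ p‖ ^ 3)⁻¹) := by
  have h2 : ω₂ ≠ 0 := by rintro rfl; simp at h
  let τ : ℍ := ⟨ω₁ / ω₂, h⟩
  have H : Summable (fun m : Fin 2 → ℤ ↦ (((m 0 : ℂ) * τ + m 1) ^ 3)⁻¹) := by
    apply summable_of_isBigO_rpow_norm (a := 3) (by linarith)
    simpa [pow_three, pow_two, ← mul_assoc] using ((isBigO_linear_add_const_vec τ 0 0).mul
        (isBigO_linear_add_const_vec τ 0 0)).mul (isBigO_linear_add_const_vec τ 0 0)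
  have H' := (((finTwoArrowEquiv _).symm.summable_iff.mpr H).norm).mul_left ((‖ω₂‖ ^ 3)⁻¹)
  refine H'.congr fun p ↦ ?_
  rw [legendre_point_eq _ _ h2]
  simp [τ, mul_pow, mul_comm]

lemma legendre_point_ne (ω₁ ω₂ : ℂ) (h : 0 < (ω₁ / ω₂).im) (p : ℤ × ℤ) (hp : p ≠ 0) :
    latticePoint ω₁ ω₂ p ≠ 0 := by
  have h2 : ω₂ ≠ 0 := by rintro rfl; simp at h
  rw [legendre_point_eq _ _ h2]
  refine mul_ne_zero h2 fun h0 ↦ hp ?_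
  have him := congrArg Complex.im h0
  simp only [add_im, mul_im, intCast_re, intCast_im, zero_mul, add_zero, zero_im,
    mul_eq_zero, h.ne', or_false] at him
  have h1 : p.1 = 0 := by exact_mod_cast him
  rw [h1] at h0
  have h3 : p.2 = 0 := by simpa using h0
  exact Prod.ext h1 h3

lemma legendre_summable (ω₁ ω₂ : ℂ) (h : 0 < (ω₁ / ω₂).im) (z : ℂ) :
    Summable (legF ω₁ ω₂ z) := by
  have hc := legendre_summable_cube ω₁ ω₂ h
  have ht := hc.tendsto_cofinite_zero
  have hpos : (0 : ℝ) < ((2 * ‖z‖ + 1) ^ 3)⁻¹ := by positivity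
  refine Summable.of_norm_bounded_eventually (hc.mul_left (2 * ‖z‖ ^ 2)) ?_
  filter_upwards [ht.eventually (gt_mem_nhds hpos), eventually_cofinite_ne (0 : ℤ × ℤ)]
    with p hp hp0
  have hP := legendre_point_ne ω₁ ω₂ h p hp0
  unfold legF
  set P := latticePoint ω₁ ω₂ p
  have hPn : 0 < ‖P‖ := norm_pos_iff.mpr hP
  have hlt : 2 * ‖z‖ + 1 < ‖P‖ := by
    rw [inv_lt_inv₀ (by positivity) (by positivity)] at hp
    exact lt_of_pow_lt_pow_left₀ 3 hPn.le hp
  have hd : ‖P‖ / 2 ≤ ‖z - P‖ := by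
    have := norm_sub_norm_le P z
    rw [norm_sub_rev] at this
    linarith
  have hzP : z - P ≠ 0 := norm_pos_iff.mp (by linarith)
  have e : 1 / (z - P) + 1 / P + z / P ^ 2 = z ^ 2 / (P ^ 2 * (z - P)) := by
    field_simp; ring
  rw [e, norm_div, norm_mul, norm_pow, norm_pow]
  calc ‖z‖ ^ 2 / (‖P‖ ^ 2 * ‖z - P‖) ≤ ‖z‖ ^ 2 / (‖P‖ ^ 2 * (‖P‖ / 2)) := by gcongr
    _ = 2 * ‖z‖ ^ 2 * (‖P‖ ^ 3)⁻¹ := by field_simp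

lemma legendre_wZeta_eq (ω₁ ω₂ : ℂ) (h : 0 < (ω₁ / ω₂).im) (z : ℂ) :
    wZeta ω₁ ω₂ z = ∑' p, legF ω₁ ω₂ z p := by
  have hs := legendre_summable ω₁ ω₂ h z
  have := hs.tsum_subtype_add_tsum_subtype_compl {(0 : ℤ × ℤ)}
  rw [← this, tsum_singleton]
  unfold wZeta
  congr 1
  simp [legF, latticePoint]

theorem legendre_relation (ω₁ ω₂ : ℂ) (h : 0 < (ω₁ / ω₂).im) (η₁ η₂ : ℂ)
    (h₁ : ∀ z : ℂ, (∀ p : ℤ × ℤ, z ≠ latticePoint ω₁ ω₂ p) →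
      wZeta ω₁ ω₂ (z + ω₁) = wZeta ω₁ ω₂ z + η₁)
    (h₂ : ∀ z : ℂ, (∀ p : ℤ × ℤ, z ≠ latticePoint ω₁ ω₂ p) →
      wZeta ω₁ ω₂ (z + ω₂) = wZeta ω₁ ω₂ z + η₂) :
    ω₁ * η₂ - ω₂ * η₁ = 2 * Real.pi * Complex.I := by
  have hw2 : ω₂ ≠ 0 := by rintro rfl; simp at h
  have hw1 : ω₁ ≠ 0 := by rintro rfl; simp at h
  have hz : ∀ p : ℤ × ℤ, ω₁ / 2 ≠ latticePoint ω₁ ω₂ p := by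
    intro p hp
    rw [legendre_point_eq _ _ hw2] at hp
    have h0 : (ω₁ / ω₂) / 2 = p.1 * (ω₁ / ω₂) + p.2 := by
      apply mul_left_cancel₀ hw2
      rw [← hp]; field_simp
    have him := congrArg Complex.im h0
    simp only [add_im, mul_im, intCast_re, intCast_im, zero_mul, add_zero, div_ofNat_im] at him
    have h3 : (2 * p.1 - 1 : ℝ) = 0 := by
      apply mul_right_cancel₀ h.ne'
      linarith
    have h4 : 2 * p.1 - 1 = 0 := by exact_mod_cast h3
    omega
  generalize ω₁ / 2 = z at hz
  let τ : ℍ := ⟨ω₁ / ω₂, h⟩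
  have hτ : (τ : ℂ) = ω₁ / ω₂ := rfl
  have hS := fun z ↦ legendre_summable ω₁ ω₂ h z
  have e1 : η₁ = ∑' p, (legF ω₁ ω₂ (z + ω₁) p - legF ω₁ ω₂ z p) := by
    rw [(hS _).tsum_sub (hS _), ← legendre_wZeta_eq _ _ h, ← legendre_wZeta_eq _ _ h, h₁ z hz]
    ring
  have e2 : η₂ = ∑' p, (legF ω₁ ω₂ (z + ω₂) p - legF ω₁ ω₂ z p) := by
    rw [(hS _).tsum_sub (hS _), ← legendre_wZeta_eq _ _ h, ← legendre_wZeta_eq _ _ h, h₂ z hz]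
    ring
  have hD1 := (hS (z + ω₁)).sub (hS z)
  have hD2 := (hS (z + ω₂)).sub (hS z)
  -- first quasi-period
  have q1 : η₁ = ω₁ / ω₂ ^ 2 * (((τ : ℂ) ^ 2)⁻¹ * G2 (ModularGroup.S • τ)) := by
    have hD1' := (Equiv.prodComm ℤ ℤ).summable_iff.mpr hD1
    have hin : ∀ n : ℤ, ∑' m : ℤ, (legF ω₁ ω₂ (z + ω₁) (m, n) - legF ω₁ ω₂ z (m, n)) =
        ω₁ / ω₂ ^ 2 * ∑' m : ℤ, 1 / ((m : ℂ) * τ + n) ^ 2 := by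
      intro n
      have hq0 : ∀ m : ℤ, 1 / ω₂ ^ 2 * (1 / ((m : ℂ) * τ + n) ^ 2) =
          1 / (m * ω₁ + n * ω₂) ^ 2 := by
        intro m
        have : (m * ω₁ + n * ω₂) = ω₂ * ((m : ℂ) * τ + n) := by rw [hτ]; field_simp
        rw [this, mul_pow, one_div_mul_one_div]
      have hq : Summable (fun m : ℤ ↦ 1 / (m * ω₁ + n * ω₂) ^ 2) := by
        have := linear_left_summable (ne_zero τ) n (k := 2) le_rfl
        refine (this.mul_left (1 / ω₂ ^ 2)).congr fun m ↦ ?_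
        rw [← hq0]; norm_cast; simp
      have hterm : ∀ m : ℤ, legF ω₁ ω₂ (z + ω₁) (m, n) - legF ω₁ ω₂ z (m, n) =
          1 / (z + ω₁ - (m * ω₁ + n * ω₂)) - 1 / (z - (m * ω₁ + n * ω₂))
            + ω₁ * (1 / (m * ω₁ + n * ω₂) ^ 2) := by
        intro m; simp only [legF, latticePoint]; ring
      have hs := hD1'.prod_factor n
      simp only [Function.comp_apply, Equiv.prodComm_apply, Prod.swap_prod_mk, hterm] at hs
      simp only [hterm]
      rw [legendre_inner ω₁ (n * ω₂) z hw1 hq hs]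
      simp_rw [← hq0]
      rw [tsum_mul_left]; ring
    have hout := hD1'.prod
    rw [e1, ← (Equiv.prodComm ℤ ℤ).tsum_eq]
    have := hD1'.tsum_prod
    simp only [Function.comp_apply, Equiv.prodComm_apply, Prod.swap_prod_mk, hin] at this hout ⊢
    rw [this, ← tsum_symmetricIco_tsum_eq_S_act, ← tsum_mul_left,
      tsum_eq_of_summable_unconditional (L := symmetricIco ℤ) hout]
  have q2 : η₂ = 1 / ω₂ * G2 τ := by
    have hin : ∀ m : ℤ, ∑' n : ℤ, (legF ω₁ ω₂ (z + ω₂) (m, n) - legF ω₁ ω₂ z (m, n)) =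
        1 / ω₂ * e2Summand m τ := by
      intro m
      have hq0 : ∀ n : ℤ, 1 / ω₂ ^ 2 * (1 / ((m : ℂ) * τ + n) ^ 2) =
          1 / (n * ω₂ + m * ω₁) ^ 2 := by
        intro n
        have : (n * ω₂ + m * ω₁) = ω₂ * ((m : ℂ) * τ + n) := by rw [hτ]; field_simp; ring
        rw [this, mul_pow, one_div_mul_one_div]
      have hq : Summable (fun n : ℤ ↦ 1 / (n * ω₂ + m * ω₁) ^ 2) := by
        have := linear_right_summable τ m (k := 2) le_rfl
        refine (this.mul_left (1 / ω₂ ^ 2)).congr fun n ↦ ?_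
        rw [← hq0]; norm_cast; simp
      have hterm : ∀ n : ℤ, legF ω₁ ω₂ (z + ω₂) (m, n) - legF ω₁ ω₂ z (m, n) =
          1 / (z + ω₂ - (n * ω₂ + m * ω₁)) - 1 / (z - (n * ω₂ + m * ω₁))
            + ω₂ * (1 / (n * ω₂ + m * ω₁) ^ 2) := by
        intro n; simp only [legF, latticePoint]; ring
      have hs := hD2.prod_factor m
      simp only [hterm] at hs
      simp only [hterm]
      rw [legendre_inner ω₂ (m * ω₁) z hw2 hq hs]
      simp_rw [← hq0]
      rw [tsum_mul_left, ← mul_assoc]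
      congr 1
      · field_simp
      · simp [e2Summand, eisSummand]
    have hout := hD2.prod
    rw [e2, hD2.tsum_prod]
    simp only [hin] at hout ⊢
    rw [G2, ← tsum_mul_left,
      tsum_eq_of_summable_unconditional (L := symmetricIcc ℤ) hout]
  have hτ0 := ne_zero τ
  rw [q1, q2, G2_S_transform τ]
  have hw : ω₁ = τ * ω₂ := by rw [hτ]; field_simp
  rw [hw]
  field_simp
  ring
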